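/- Let X be a compact metric space and let D be a dense subset of the space C(X, ℝ) of continuous real-valued functions on X equipped with the supremum metric. Then for any two nonempty disjoint compact subsets A and B of X, there exists a function f ∈ D such that f(a) > 0 for all a ∈ A and f(b) < 0 for all b ∈ B. (Proposition 1: every universal kernel — i.e., every kernel whose induced function space is dense in C(X) — separates all compact subsets of X.) -/

import Mathlib

/-- Proposition 1: if `D` is dense in `C(X, ℝ)` (sup metric) for a compact metric space `X`
— e.g. the span of a universal kernel — then `D` separates every pair of nonempty disjoint
compact subsets of `X`. -/
theorem dense_separates_compacts
    (X : Type*) [MetricSpace X] [CompactSpace X]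
    (D : Set C(X, ℝ)) (hD : Dense D)
    (A B : Set X) (hA : IsCompact A) (hB : IsCompact B)
    (hAne : A.Nonempty) (hBne : B.Nonempty) (hAB : Disjoint A B) :
    ∃ f ∈ D, (∀ a ∈ A, 0 < f a) ∧ (∀ b ∈ B, f b < 0) := by
  obtain ⟨g, hg0, hg1, -⟩ :=
    exists_continuous_zero_one_of_isClosed hB.isClosed hA.isClosed hAB.symm
  obtain ⟨f, hfD, hf⟩ :=
    hD.exists_dist_lt (g - ContinuousMap.const X (1 / 2)) (one_half_pos (α := ℝ))
  have hclose (x : X) : |g x - 1 / 2 - f x| < 1 / 2 :=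
    (ContinuousMap.dist_apply_le_dist x).trans_lt hf
  refine ⟨f, hfD, fun a ha => ?_, fun b hb => ?_⟩
  · have hga : g a = 1 := hg1 ha
    linarith [(abs_lt.mp (hclose a)).2]
  · have hgb : g b = 0 := hg0 hb
    linarith [(abs_lt.mp (hclose b)).1]
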